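/- Let ξ₀, ξ₁₂ : ℂ → ℂ be holomorphic with no common zero and let J be the warped product structure on ℝ⁶ determined by (ξ₀, ξ₁₂). For x ∈ ℝ⁶ and indices a,b ∈ {1,…,6} set ω_{ab}(x) = ⟨J(x)e_a, e_b⟩ (the Kähler form of J with respect to the Euclidean metric), and define σ_{abcd} = ω_{ab}ω_{cd} − ω_{ac}ω_{bd} + ω_{ad}ω_{bc} (the components of ω∧ω). Then J is cosymplectic: for every choice of indices 1 ≤ a < b < c < d < e ≤ 6, the alternating sum ∂_a σ_{bcde} − ∂_b σ_{acde} + ∂_c σ_{abde} − ∂_d σ_{abce} + ∂_e σ_{abcd} vanishes identically on ℝ⁶ (i.e. the 4-form ω∧ω is closed). -/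

import Mathlib

open Matrix Filter

attribute [local instance] Matrix.normedAddCommGroup Matrix.normedSpace

/-- The warped product almost complex structure on `ℝ⁶ = ℂ³` (real coordinates ordered
`(x₁,y₁,x₂,y₂,x₃,y₃)`) determined by `(ξ₀, ξ₁₂)`: block diagonal `J₁(z₃) ⊕ J₀`. -/
noncomputable def wpsJ (ξ₀ ξ₁₂ : ℂ → ℂ) (x : Fin 6 → ℝ) : Matrix (Fin 6) (Fin 6) ℝ :=
  let z : ℂ := (x 4 : ℂ) + (x 5 : ℂ) * Complex.I
  let a : ℝ := Complex.normSq (ξ₀ z)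
  let b : ℝ := Complex.normSq (ξ₁₂ z)
  let f : ℝ := ((starRingEnd ℂ) (ξ₀ z) * ξ₁₂ z).re
  let g : ℝ := ((starRingEnd ℂ) (ξ₀ z) * ξ₁₂ z).im
  (a + b)⁻¹ • !![0, b - a, -(2*g), 2*f, 0, 0;
                 a - b, 0, 2*f, 2*g, 0, 0;
                 2*g, -(2*f), 0, b - a, 0, 0;
                 -(2*f), -(2*g), a - b, 0, 0, 0;
                 0, 0, 0, 0, 0, -(a + b);
                 0, 0, 0, 0, a + b, 0]

/-- The Kähler form of `J` with respect to the Euclidean metric: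
`ω_{ab}(x) = ⟨J(x)e_a, e_b⟩`. -/
noncomputable def omegaJ (ξ₀ ξ₁₂ : ℂ → ℂ) (x : Fin 6 → ℝ) (a b : Fin 6) : ℝ :=
  (wpsJ ξ₀ ξ₁₂ x).mulVec (Pi.single a 1) ⬝ᵥ Pi.single b 1

/-- The components `σ_{abcd} = ω_{ab}ω_{cd} − ω_{ac}ω_{bd} + ω_{ad}ω_{bc}` of `ω ∧ ω`. -/
noncomputable def sigmaJ (ξ₀ ξ₁₂ : ℂ → ℂ) (a b c d : Fin 6) (x : Fin 6 → ℝ) : ℝ :=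
  omegaJ ξ₀ ξ₁₂ x a b * omegaJ ξ₀ ξ₁₂ x c d
    - omegaJ ξ₀ ξ₁₂ x a c * omegaJ ξ₀ ξ₁₂ x b d
    + omegaJ ξ₀ ξ₁₂ x a d * omegaJ ξ₀ ξ₁₂ x b c

/-- Partial derivative in the `a`-th real coordinate direction. -/
noncomputable def pderiv6 (a : Fin 6) (h : (Fin 6 → ℝ) → ℝ) (x : Fin 6 → ℝ) : ℝ :=
  fderiv ℝ h x (Pi.single a 1)

theorem omegaJ_eq_wpsJ (ξ₀ ξ₁₂ : ℂ → ℂ) (x : Fin 6 → ℝ) (i j : Fin 6) :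
    omegaJ ξ₀ ξ₁₂ x i j = wpsJ ξ₀ ξ₁₂ x j i := by
  simp [omegaJ]

/-- The first four coordinate directions are `ω`-orthogonal to the last two. -/
theorem omegaJ_eq_zero_of_lt_of_le (ξ₀ ξ₁₂ : ℂ → ℂ) (x : Fin 6 → ℝ) {i j : Fin 6}
    (hi : i < 4) (hj : 4 ≤ j) : omegaJ ξ₀ ξ₁₂ x i j = 0 := by
  rw [omegaJ_eq_wpsJ]
  fin_cases i <;> first | exact absurd hi (by decide) | skip
  all_goals fin_cases j <;> first | exact absurd hj (by decide) | simp [wpsJ]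

theorem sigmaJ_eq_zero_of_lt_of_le (ξ₀ ξ₁₂ : ℂ → ℂ) (x : Fin 6 → ℝ) {b c d e : Fin 6}
    (hb : b < 4) (hc : c < 4) (hd : d < 4) (he : 4 ≤ e) : sigmaJ ξ₀ ξ₁₂ b c d e x = 0 := by
  simp [sigmaJ, omegaJ_eq_zero_of_lt_of_le, hb, hc, hd, he]

/-- Away from common zeros, `ω ∧ ω` restricts to a constant multiple of the volume form on the
first four coordinates. -/
theorem sigmaJ_zero_one_two_three (ξ₀ ξ₁₂ : ℂ → ℂ)
    (hnz : ∀ z : ℂ, ¬(ξ₀ z = 0 ∧ ξ₁₂ z = 0)) (x : Fin 6 → ℝ) :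
    sigmaJ ξ₀ ξ₁₂ 0 1 2 3 x = 1 := by
  have hρ : Complex.normSq (ξ₀ (x 4 + x 5 * Complex.I)) +
      Complex.normSq (ξ₁₂ (x 4 + x 5 * Complex.I)) ≠ 0 := by
    intro h
    rw [add_eq_zero_iff_of_nonneg (Complex.normSq_nonneg _) (Complex.normSq_nonneg _),
      Complex.normSq_eq_zero, Complex.normSq_eq_zero] at h
    exact hnz _ h
  simp only [sigmaJ, omegaJ_eq_wpsJ]
  simp [wpsJ]
  field_simp
  simp only [Complex.normSq_apply]
  ring

theorem sigmaJ_add_smul_single (ξ₀ ξ₁₂ : ℂ → ℂ) (b c d e : Fin 6) (x : Fin 6 → ℝ) {a : Fin 6}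
    (ha : a < 4) (t : ℝ) :
    sigmaJ ξ₀ ξ₁₂ b c d e (x + t • Pi.single a 1) = sigmaJ ξ₀ ξ₁₂ b c d e x := by
  have h₄ : (4 : Fin 6) ≠ a := ha.ne'
  have h₅ : (5 : Fin 6) ≠ a := (ha.trans (by decide)).ne'
  simp [sigmaJ, omegaJ, wpsJ, h₄, h₅]

theorem pderiv6_eq_zero_of_forall_add_smul {a : Fin 6} {h : (Fin 6 → ℝ) → ℝ} {x : Fin 6 → ℝ}
    (hc : ∀ t : ℝ, h (x + t • Pi.single a 1) = h x) : pderiv6 a h x = 0 := by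
  by_cases hd : DifferentiableAt ℝ h x
  · rw [pderiv6, ← hd.lineDeriv_eq_fderiv, lineDeriv]
    simp [hc]
  · simp [pderiv6, fderiv_zero_of_not_differentiableAt hd]

/-- Every partial derivative occurring in the exterior derivative of `ω ∧ ω` vanishes. -/
theorem pderiv6_sigmaJ_eq_zero (ξ₀ ξ₁₂ : ℂ → ℂ)
    (hnz : ∀ z : ℂ, ¬(ξ₀ z = 0 ∧ ξ₁₂ z = 0)) {a b c d e : Fin 6}
    (hbc : b < c) (hcd : c < d) (hde : d < e)
    (hd : a ≠ d) (he : a ≠ e) (x : Fin 6 → ℝ) :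
    pderiv6 a (sigmaJ ξ₀ ξ₁₂ b c d e) x = 0 := by
  apply pderiv6_eq_zero_of_forall_add_smul
  intro t
  by_cases ha : a < 4
  · exact sigmaJ_add_smul_single ξ₀ ξ₁₂ b c d e x ha t
  have hd4 : d < 4 := by omega
  by_cases he4 : e < 4
  · obtain ⟨rfl, rfl, rfl, rfl⟩ : b = 0 ∧ c = 1 ∧ d = 2 ∧ e = 3 := by omega
    simp only [sigmaJ_zero_one_two_three ξ₀ ξ₁₂ hnz]
  · have hc4 := hcd.trans hd4
    have hb4 := hbc.trans hc4
    simp only [sigmaJ_eq_zero_of_lt_of_le ξ₀ ξ₁₂ _ hb4 hc4 hd4 (not_lt.mp he4)]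

/-- A warped product orthogonal complex structure on `ℝ⁶` is cosymplectic:
the 4-form `ω ∧ ω` is closed. -/
theorem warped_product_is_cosymplectic (ξ₀ ξ₁₂ : ℂ → ℂ)
    (h₀ : Differentiable ℂ ξ₀) (h₁₂ : Differentiable ℂ ξ₁₂)
    (hnz : ∀ z : ℂ, ¬(ξ₀ z = 0 ∧ ξ₁₂ z = 0)) :
    ∀ (a b c d e : Fin 6), a < b → b < c → c < d → d < e → ∀ x : Fin 6 → ℝ,
      pderiv6 a (sigmaJ ξ₀ ξ₁₂ b c d e) x
        - pderiv6 b (sigmaJ ξ₀ ξ₁₂ a c d e) x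
        + pderiv6 c (sigmaJ ξ₀ ξ₁₂ a b d e) x
        - pderiv6 d (sigmaJ ξ₀ ξ₁₂ a b c e) x
        + pderiv6 e (sigmaJ ξ₀ ξ₁₂ a b c d) x = 0 := by
  intro a b c d e hab hbc hcd hde x
  have had := hab.trans (hbc.trans hcd)
  have hbd := hbc.trans hcd
  have hce := hcd.trans hde
  rw [pderiv6_sigmaJ_eq_zero ξ₀ ξ₁₂ hnz hbc hcd hde had.ne (had.trans hde).ne,
    pderiv6_sigmaJ_eq_zero ξ₀ ξ₁₂ hnz (hab.trans hbc) hcd hde hbd.ne (hbd.trans hde).ne,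
    pderiv6_sigmaJ_eq_zero ξ₀ ξ₁₂ hnz hab hbd hde hcd.ne hce.ne,
    pderiv6_sigmaJ_eq_zero ξ₀ ξ₁₂ hnz hab hbc hce hcd.ne' hde.ne,
    pderiv6_sigmaJ_eq_zero ξ₀ ξ₁₂ hnz hab hbc hcd hce.ne' hde.ne']
  simp
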